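/- There exist constants A₂ > 0 and C > 0 such that the non-increasing rearrangement of the function x ↦ G_{1/2}(ρ(x)) on B⁴ with respect to hyperbolic volume satisfies: (i) [G_{1/2}(ρ(·))]*(t) ≤ (2^{1/4}/(8√π t^{3/4})) · (1 + A₂ √t) for all t > 0, and (ii) [G_{1/2}(ρ(·))]*(t) ≤ C/(√t · ln t) for all t > 2. -/

import Mathlib

open MeasureTheory Real

noncomputable section

/-- The Euclidean space `ℝ⁴`. -/
abbrev E4 := EuclideanSpace ℝ (Fin 4)

/-- The hyperbolic volume measure on the Poincaré ball `B⁴`: Lebesgue measure restricted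
to the unit ball, with density `(2/(1-|x|²))⁴`. -/
def hypVol : Measure E4 :=
  (volume.restrict (Metric.ball (0 : E4) 1)).withDensity
    (fun x => ENNReal.ofReal ((2 / (1 - ‖x‖ ^ 2)) ^ 4))

/-- The hyperbolic distance from the origin in the Poincaré ball. -/
def rhyp (x : E4) : ℝ := Real.log ((1 + ‖x‖) / (1 - ‖x‖))

/-- The non-increasing rearrangement of a function on `B⁴` with respect to the
hyperbolic volume. -/
def rearr (f : E4 → ℝ) (t : ℝ) : ℝ :=
  sInf {s : ℝ | 0 < s ∧ hypVol {x : E4 | s < |f x|} ≤ ENNReal.ofReal t}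

end
noncomputable section

/-- The kernel of `(-Δ_ℍ - 9/4)^{-1/2}` on 4-dimensional hyperbolic space. -/
def Ghalf (ρ : ℝ) : ℝ :=
  (2 / (Real.sqrt π * (2 * π) ^ ((5 : ℝ) / 2))) *
    ∫ r in Set.Ioi ρ,
      (1 / Real.sqrt (Real.cosh r - Real.cosh ρ)) *
        (1 / (r ^ 2 * Real.sinh r) + Real.cosh r / (r * Real.sinh r ^ 2))

end

open Set Filter Topology

/-- The integrand in the formula for `Ghalf ρ`. -/
noncomputable def ghalfIntegrand (ρ r : ℝ) : ℝ :=
  (1 / √(cosh r - cosh ρ)) * (1 / (r ^ 2 * sinh r) + cosh r / (r * sinh r ^ 2))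

theorem ghalfIntegrand_nonneg {ρ r : ℝ} (hr : 0 < r) : 0 ≤ ghalfIntegrand ρ r := by
  have h1 := sinh_pos_iff.2 hr
  have h2 := cosh_pos r
  unfold ghalfIntegrand
  positivity

theorem cosh_sub_cosh_eq (r ρ : ℝ) :
    cosh r - cosh ρ = 2 * sinh ((r + ρ) / 2) * sinh ((r - ρ) / 2) := by
  have h1 : cosh r = cosh ((r + ρ) / 2 + (r - ρ) / 2) := by congr 1; ring
  have h2 : cosh ρ = cosh ((r + ρ) / 2 - (r - ρ) / 2) := by congr 1; ring
  rw [h1, h2, cosh_add, cosh_sub]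
  ring

theorem sq_sub_sq_div_two_le_cosh_sub_cosh {ρ r : ℝ} (hρ : 0 ≤ ρ) (hr : ρ ≤ r) :
    (r ^ 2 - ρ ^ 2) / 2 ≤ cosh r - cosh ρ := by
  rw [cosh_sub_cosh_eq]
  have h1 : (r + ρ) / 2 ≤ sinh ((r + ρ) / 2) := self_le_sinh_iff.2 (by linarith)
  have h2 : (r - ρ) / 2 ≤ sinh ((r - ρ) / 2) := self_le_sinh_iff.2 (by linarith)
  have h3 := mul_le_mul h1 h2 (by linarith) (by linarith)
  linarith

theorem sub_mul_sinh_le_cosh_sub_cosh {ρ r : ℝ} (hρ : 0 ≤ ρ) (hr : ρ ≤ r) :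
    (r - ρ) * sinh ρ ≤ cosh r - cosh ρ := by
  rw [cosh_sub_cosh_eq]
  have h0 : 0 ≤ sinh ρ := sinh_nonneg_iff.2 hρ
  have h1 : sinh ρ ≤ sinh ((r + ρ) / 2) := sinh_le_sinh.2 (by linarith)
  have h2 : (r - ρ) / 2 ≤ sinh ((r - ρ) / 2) := self_le_sinh_iff.2 (by linarith)
  have h3 := mul_le_mul h1 h2 (by linarith) (by linarith)
  linarith

theorem cosh_div_sinh_sq_le {r : ℝ} (hr : 0 < r) : cosh r / sinh r ^ 2 ≤ 1 / r ^ 2 + 1 := by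
  have h1 := sinh_pos_iff.2 hr
  have h2 : r ≤ sinh r := self_le_sinh_iff.2 hr.le
  have h3 := one_le_cosh r
  have h4 := cosh_sq r
  calc cosh r / sinh r ^ 2 ≤ (1 + sinh r ^ 2) / sinh r ^ 2 := by gcongr; nlinarith
    _ = 1 / sinh r ^ 2 + 1 := by field_simp
    _ ≤ 1 / r ^ 2 + 1 := by gcongr

theorem ghalfIntegrand_le {ρ r : ℝ} (hρ : 0 < ρ) (hr : ρ < r) :
    ghalfIntegrand ρ r ≤ √2 * ((1 / √(r ^ 2 - ρ ^ 2)) * (2 / r ^ 3 + 1 / r)) := by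
  have hr0 : 0 < r := hρ.trans hr
  have h1 := sinh_pos_iff.2 hr0
  have h2 : r ≤ sinh r := self_le_sinh_iff.2 hr0.le
  have hd : 0 < r ^ 2 - ρ ^ 2 := by nlinarith
  have hA : 1 / √(cosh r - cosh ρ) ≤ √2 * (1 / √(r ^ 2 - ρ ^ 2)) := by
    have h3 := sq_sub_sq_div_two_le_cosh_sub_cosh hρ.le hr.le
    calc 1 / √(cosh r - cosh ρ) ≤ 1 / √((r ^ 2 - ρ ^ 2) / 2) := by gcongr
      _ = √2 * (1 / √(r ^ 2 - ρ ^ 2)) := by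
        rw [sqrt_div hd.le]; field_simp
  have hB : 1 / (r ^ 2 * sinh r) + cosh r / (r * sinh r ^ 2) ≤ 2 / r ^ 3 + 1 / r := by
    calc 1 / (r ^ 2 * sinh r) + cosh r / (r * sinh r ^ 2)
        = 1 / (r ^ 2 * sinh r) + (1 / r) * (cosh r / sinh r ^ 2) := by field_simp
      _ ≤ 1 / (r ^ 2 * r) + (1 / r) * (1 / r ^ 2 + 1) := by
        gcongr
        exact cosh_div_sinh_sq_le hr0
      _ = _ := by field_simp; ring
  have hc := cosh_pos r
  calc ghalfIntegrand ρ r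
      ≤ (√2 * (1 / √(r ^ 2 - ρ ^ 2))) * (2 / r ^ 3 + 1 / r) :=
        mul_le_mul hA hB (by positivity) (by positivity)
    _ = _ := by ring

theorem hasDerivAt_majorant {ρ r : ℝ} (hρ : 0 < ρ) (hr : ρ < r) :
    HasDerivAt (fun r => √2 * (√(r ^ 2 - ρ ^ 2) / (ρ ^ 2 * r ^ 2) +
        (1 / ρ ^ 3 + 1 / ρ) * arctan (√(r ^ 2 - ρ ^ 2) / ρ)))
      (√2 * ((1 / √(r ^ 2 - ρ ^ 2)) * (2 / r ^ 3 + 1 / r))) r := by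
  have hr0 : 0 < r := hρ.trans hr
  have hd : 0 < r ^ 2 - ρ ^ 2 := by nlinarith
  have hw : HasDerivAt (fun r : ℝ => √(r ^ 2 - ρ ^ 2)) (r / √(r ^ 2 - ρ ^ 2)) r := by
    have := (((hasDerivAt_pow 2 r).sub_const (ρ ^ 2)).sqrt hd.ne')
    refine this.congr_deriv ?_
    field_simp
    norm_num [mul_comm]
  have h1 := hw.div (((hasDerivAt_pow 2 r).const_mul (ρ ^ 2))) (by positivity)
  have h2 := ((hw.div_const ρ).arctan).const_mul (1 / ρ ^ 3 + 1 / ρ)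
  have h3 := (h1.add h2).const_mul (√2)
  refine h3.congr_deriv ?_
  congr 1
  have hs := sq_sqrt hd.le
  have hw0 : 0 < √(r ^ 2 - ρ ^ 2) := sqrt_pos.2 hd
  rw [div_pow, hs]
  have : (1 + (r ^ 2 - ρ ^ 2) / ρ ^ 2) = r ^ 2 / ρ ^ 2 := by field_simp; ring
  rw [this]
  field_simp
  rw [hs]
  norm_num
  ring

theorem tendsto_majorant {ρ : ℝ} (hρ : 0 < ρ) :
    Tendsto (fun r => √2 * (√(r ^ 2 - ρ ^ 2) / (ρ ^ 2 * r ^ 2) +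
        (1 / ρ ^ 3 + 1 / ρ) * arctan (√(r ^ 2 - ρ ^ 2) / ρ))) atTop
      (𝓝 (√2 * (0 + (1 / ρ ^ 3 + 1 / ρ) * (π / 2)))) := by
  have hT : Tendsto (fun r : ℝ => √(r ^ 2 - ρ ^ 2)) atTop atTop :=
    tendsto_sqrt_atTop.comp
      (tendsto_atTop_add_const_right _ (-ρ ^ 2) (tendsto_pow_atTop two_ne_zero))
  refine Tendsto.const_mul _ (Tendsto.add ?_ (Tendsto.const_mul _ ?_))
  · refine squeeze_zero' (g := fun r => (1 / ρ ^ 2) * r⁻¹) ?_ ?_ ?_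
    · filter_upwards [eventually_gt_atTop 0] with r hr
      positivity
    · filter_upwards [eventually_gt_atTop 0] with r hr
      have : √(r ^ 2 - ρ ^ 2) ≤ r := sqrt_le_iff.2 ⟨hr.le, by nlinarith⟩
      calc √(r ^ 2 - ρ ^ 2) / (ρ ^ 2 * r ^ 2) ≤ r / (ρ ^ 2 * r ^ 2) := by gcongr
        _ = _ := by field_simp
    · have h := (tendsto_inv_atTop_zero (𝕜 := ℝ)).const_mul (1 / ρ ^ 2)
      rwa [mul_zero] at h
  · exact (tendsto_nhds_of_tendsto_nhdsWithin tendsto_arctan_atTop).comp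
      (hT.atTop_div_const hρ)

theorem ghalf_const_eq :
    2 / (√π * (2 * π) ^ ((5 : ℝ) / 2)) * (√2 * (π / 2)) = 1 / (4 * π ^ 2) := by
  have h : (2 * π) ^ ((5 : ℝ) / 2) = 4 * π ^ 2 * (√2 * √π) := by
    rw [← sqrt_mul (by norm_num), show (5 : ℝ) / 2 = (2 : ℕ) + 1 / 2 by norm_num,
      rpow_add (by positivity), rpow_natCast, ← sqrt_eq_rpow]
    ring
  rw [h]
  have := sq_sqrt pi_pos.le
  have h2 : 0 < √π := sqrt_pos.2 pi_pos
  field_simp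
  nlinarith

theorem Ghalf_nonneg {ρ : ℝ} (hρ : 0 < ρ) : 0 ≤ Ghalf ρ :=
  mul_nonneg (by positivity)
    (setIntegral_nonneg measurableSet_Ioi fun _ hr => ghalfIntegrand_nonneg (hρ.trans hr))

theorem Ghalf_le_of_hasDerivAt {ρ l : ℝ} {g g' : ℝ → ℝ} (hρ : 0 < ρ)
    (hcont : ContinuousWithinAt g (Ici ρ) ρ) (hderiv : ∀ r ∈ Ioi ρ, HasDerivAt g (g' r) r)
    (hle : ∀ r ∈ Ioi ρ, ghalfIntegrand ρ r ≤ g' r) (hg : Tendsto g atTop (𝓝 l)) :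
    Ghalf ρ ≤ 2 / (√π * (2 * π) ^ ((5 : ℝ) / 2)) * (l - g ρ) := by
  have hnn : ∀ r ∈ Ioi ρ, 0 ≤ ghalfIntegrand ρ r := fun r hr =>
    ghalfIntegrand_nonneg (hρ.trans hr)
  have hpos : ∀ r ∈ Ioi ρ, 0 ≤ g' r := fun r hr => (hnn r hr).trans (hle r hr)
  rw [← integral_Ioi_of_hasDerivAt_of_nonneg hcont hderiv hpos hg]
  refine mul_le_mul_of_nonneg_left ?_ (by positivity)
  exact integral_mono_of_nonneg (ae_restrict_of_forall_mem measurableSet_Ioi hnn)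
    (integrableOn_Ioi_deriv_of_nonneg hcont hderiv hpos hg)
    (ae_restrict_of_forall_mem measurableSet_Ioi hle)

theorem Ghalf_le {ρ : ℝ} (hρ : 0 < ρ) : Ghalf ρ ≤ (1 + ρ ^ 2) / (4 * π ^ 2 * ρ ^ 3) := by
  refine (Ghalf_le_of_hasDerivAt hρ ?_ (fun r hr => hasDerivAt_majorant hρ hr)
    (fun r hr => ghalfIntegrand_le hρ hr) (tendsto_majorant hρ)).trans_eq ?_
  · refine ContinuousAt.continuousWithinAt ?_
    have : ρ ^ 2 * ρ ^ 2 ≠ 0 := by positivity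
    fun_prop (disch := assumption)
  · calc _ = 2 / (√π * (2 * π) ^ ((5 : ℝ) / 2)) * (√2 * (π / 2)) * (1 / ρ ^ 3 + 1 / ρ) := by
          simp; ring
      _ = _ := by rw [ghalf_const_eq]; field_simp

theorem exp_div_four_le_sinh {r : ℝ} (hr : 1 ≤ r) : exp r / 4 ≤ sinh r := by
  have h1 : exp (-r) ≤ 1 := exp_le_one_iff.2 (by linarith)
  have h2 := add_one_le_exp r
  rw [sinh_eq]
  linarith

theorem ghalfIntegrand_le_of_one_le {ρ r : ℝ} (hρ : 1 ≤ ρ) (hr : ρ < r) :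
    ghalfIntegrand ρ r ≤ 40 * exp (-(3 / 2 * ρ)) / ρ * (1 / (√(r - ρ) * (1 + (r - ρ)))) := by
  have hρ0 : 0 < ρ := by linarith
  have hr0 : 0 < r := hρ0.trans hr
  have hu : 0 < r - ρ := sub_pos.2 hr
  have hA : 1 / √(cosh r - cosh ρ) ≤ 2 * exp (-(ρ / 2)) * (1 / √(r - ρ)) := by
    have h3 := sub_mul_sinh_le_cosh_sub_cosh hρ0.le hr.le
    have h4 := exp_div_four_le_sinh hρ
    have h5 : (r - ρ) * (exp (ρ / 2) / 2) ^ 2 ≤ cosh r - cosh ρ := by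
      rw [div_pow, ← exp_nat_mul, show ((2 : ℕ) : ℝ) * (ρ / 2) = ρ by push_cast; ring]
      nlinarith
    calc 1 / √(cosh r - cosh ρ) ≤ 1 / √((r - ρ) * (exp (ρ / 2) / 2) ^ 2) := by gcongr
      _ = _ := by
        rw [sqrt_mul hu.le, sqrt_sq (by positivity), exp_neg]; field_simp
  have hB : 1 / (r ^ 2 * sinh r) + cosh r / (r * sinh r ^ 2) ≤ 20 * exp (-r) / ρ := by
    have h4 := exp_div_four_le_sinh (hρ.trans hr.le)
    have hc : cosh r ≤ exp r := by
      rw [cosh_eq]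
      have : exp (-r) ≤ exp r := exp_le_exp.2 (by linarith)
      linarith
    have hr1 : 1 ≤ r := hρ.trans hr.le
    calc 1 / (r ^ 2 * sinh r) + cosh r / (r * sinh r ^ 2)
        ≤ 1 / ((ρ * 1) * (exp r / 4)) + exp r / (ρ * (exp r / 4) ^ 2) := by
          rw [pow_two r]
          gcongr
      _ = _ := by rw [exp_neg]; field_simp; ring
  have hE : exp (-r) ≤ exp (-ρ) * (1 / (1 + (r - ρ))) := by
    have h := add_one_le_exp (r - ρ)
    calc exp (-r) = exp (-ρ) * (1 / exp (r - ρ)) := by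
          rw [one_div, ← exp_neg, ← exp_add]; congr 1; ring
      _ ≤ _ := by gcongr; linarith
  have hs := sinh_pos_iff.2 hr0
  have hc := cosh_pos r
  calc ghalfIntegrand ρ r
      ≤ (2 * exp (-(ρ / 2)) * (1 / √(r - ρ))) * (20 * exp (-r) / ρ) :=
        mul_le_mul hA hB (by positivity) (by positivity)
    _ ≤ (2 * exp (-(ρ / 2)) * (1 / √(r - ρ))) *
          (20 * (exp (-ρ) * (1 / (1 + (r - ρ)))) / ρ) := by gcongr
    _ = 40 * (exp (-(ρ / 2)) * exp (-ρ)) / ρ * (1 / (√(r - ρ) * (1 + (r - ρ)))) := by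
        field_simp; norm_num
    _ = _ := by rw [← exp_add]; congr 4; ring

theorem exists_Ghalf_le_exp : ∃ K : ℝ, 0 < K ∧
    ∀ ρ : ℝ, 1 ≤ ρ → Ghalf ρ ≤ K * (exp (-(3 / 2 * ρ)) / ρ) := by
  refine ⟨2 / (√π * (2 * π) ^ ((5 : ℝ) / 2)) * (40 * π), by positivity, fun ρ hρ => ?_⟩
  have hρ0 : 0 < ρ := by linarith
  refine (Ghalf_le_of_hasDerivAt hρ0
    (g := fun r => 40 * exp (-(3 / 2 * ρ)) / ρ * (2 * arctan √(r - ρ)))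
    (l := 40 * exp (-(3 / 2 * ρ)) / ρ * (2 * (π / 2)))
    (ContinuousAt.continuousWithinAt (by fun_prop)) (fun r hr => ?_)
    (fun r hr => ghalfIntegrand_le_of_one_le hρ hr) ?_).trans_eq ?_
  · have hu : 0 < r - ρ := sub_pos.2 hr
    have h := ((((hasDerivAt_id r).sub_const ρ).sqrt hu.ne').arctan.const_mul 2).const_mul
      (40 * exp (-(3 / 2 * ρ)) / ρ)
    refine h.congr_deriv ?_
    simp only [id, sq_sqrt hu.le]
    field_simp
  · refine Tendsto.const_mul _ (Tendsto.const_mul _ ?_)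
    exact (tendsto_nhds_of_tendsto_nhdsWithin tendsto_arctan_atTop).comp
      (tendsto_sqrt_atTop.comp (tendsto_atTop_add_const_right _ (-ρ) tendsto_id))
  · simp
    ring

/-- The Euclidean radius of the hyperbolic ball of radius `ρ` centred at the origin. -/
noncomputable def ballRadius (ρ : ℝ) : ℝ := (exp ρ - 1) / (exp ρ + 1)

theorem ballRadius_pos {ρ : ℝ} (hρ : 0 < ρ) : 0 < ballRadius ρ :=
  div_pos (by linarith [one_lt_exp_iff.2 hρ]) (by positivity)

theorem ballRadius_lt_one (ρ : ℝ) : ballRadius ρ < 1 :=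
  (div_lt_one (by positivity)).2 (by linarith)

theorem one_sub_ballRadius_sq (ρ : ℝ) :
    1 - ballRadius ρ ^ 2 = 4 * exp ρ / (exp ρ + 1) ^ 2 := by
  have : exp ρ + 1 ≠ 0 := by positivity
  rw [ballRadius]
  field_simp
  ring

theorem two_mul_ballRadius_div (ρ : ℝ) :
    2 * ballRadius ρ / (1 - ballRadius ρ ^ 2) = sinh ρ := by
  have : exp ρ + 1 ≠ 0 := by positivity
  rw [one_sub_ballRadius_sq, ballRadius, sinh_eq, exp_neg]
  field_simp
  ring

theorem inv_one_sub_ballRadius_sq_le {ρ : ℝ} (hρ : 0 ≤ ρ) :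
    1 / (1 - ballRadius ρ ^ 2) ≤ exp ρ := by
  have h := one_le_exp_iff.2 hρ
  rw [one_sub_ballRadius_sq, one_div_div, div_le_iff₀ (by positivity)]
  nlinarith

theorem le_rhyp {ρ : ℝ} {x : E4} (h : ballRadius ρ ≤ ‖x‖) (hx : ‖x‖ < 1) : ρ ≤ rhyp x := by
  have h1 : 0 < 1 - ‖x‖ := by linarith
  have h2 : 0 < 1 + ‖x‖ := by positivity
  rw [rhyp, le_log_iff_exp_le (by positivity), le_div_iff₀ h1]
  rw [ballRadius, div_le_iff₀ (by positivity)] at h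
  linarith

theorem volume_ball_zero_E4 {R : ℝ} (hR : 0 ≤ R) :
    volume (Metric.ball (0 : E4) R) = ENNReal.ofReal (π ^ 2 / 2 * R ^ 4) := by
  rw [InnerProductSpace.volume_ball_of_dim_even (k := 2) (by simp), finrank_euclideanSpace_fin,
    ← ENNReal.ofReal_pow hR, ← ENNReal.ofReal_mul (by positivity)]
  norm_num [mul_comm]

theorem hypVol_ball {R : ℝ} (hR : R ≤ 1) :
    hypVol (Metric.ball 0 R) =
      ∫⁻ x in Metric.ball (0 : E4) R, ENNReal.ofReal ((2 / (1 - ‖x‖ ^ 2)) ^ 4) := by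
  rw [hypVol, withDensity_apply _ Metric.isOpen_ball.measurableSet,
    Measure.restrict_restrict Metric.isOpen_ball.measurableSet,
    inter_eq_left.2 (Metric.ball_subset_ball hR)]

theorem hypVol_compl_ball : hypVol (Metric.ball (0 : E4) 1)ᶜ = 0 := by
  refine withDensity_absolutelyContinuous _ _ ?_
  rw [Measure.restrict_apply Metric.isOpen_ball.measurableSet.compl, compl_inter_self,
    measure_empty]

theorem hypVol_ball_le_sinh {ρ : ℝ} (hρ : 0 < ρ) :
    hypVol (Metric.ball 0 (ballRadius ρ)) ≤ ENNReal.ofReal (π ^ 2 / 2 * sinh ρ ^ 4) := by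
  have hR := ballRadius_pos hρ
  have hR1 := ballRadius_lt_one ρ
  have hd : 0 < 1 - ballRadius ρ ^ 2 := by nlinarith
  rw [hypVol_ball hR1.le]
  calc _ ≤ ∫⁻ x in Metric.ball (0 : E4) (ballRadius ρ),
        ENNReal.ofReal ((2 / (1 - ballRadius ρ ^ 2)) ^ 4) := by
        refine setLIntegral_mono measurable_const fun x hx => ?_
        rw [mem_ball_zero_iff] at hx
        have hx2 : ‖x‖ ^ 2 ≤ ballRadius ρ ^ 2 := by gcongr
        have hx1 : 0 < 1 - ‖x‖ ^ 2 := by linarith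
        gcongr
    _ = ENNReal.ofReal (π ^ 2 / 2 * sinh ρ ^ 4) := by
        rw [setLIntegral_const, volume_ball_zero_E4 hR.le, ← ENNReal.ofReal_mul (by positivity),
          ← two_mul_ballRadius_div]
        congr 1
        ring

theorem intervalIntegral_radial_density_le {R : ℝ} (hR : 0 < R) (hR1 : R < 1) :
    ∫ r in (0 : ℝ)..R, r ^ 3 * (2 / (1 - r ^ 2)) ^ 4 ≤ 8 / 3 * (1 / (1 - R ^ 2)) ^ 3 := by
  have hne : ∀ r ∈ uIcc 0 R, 1 - r ^ 2 ≠ 0 := by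
    intro r hr
    rw [uIcc_of_le hR.le] at hr
    have := hr.1
    have := hr.2
    nlinarith
  have hc : ContinuousOn (fun r : ℝ => r ^ 3 * (2 / (1 - r ^ 2)) ^ 4) (uIcc 0 R) := by
    fun_prop (disch := assumption)
  have hc' : ContinuousOn (fun r : ℝ => 16 * r / (1 - r ^ 2) ^ 4) (uIcc 0 R) :=
    ContinuousOn.div (by fun_prop) (by fun_prop) fun r hr => pow_ne_zero _ (hne r hr)
  have hder : ∀ r ∈ uIcc 0 R, HasDerivAt (fun r : ℝ => 8 / 3 * ((1 - r ^ 2)⁻¹) ^ 3)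
      (16 * r / (1 - r ^ 2) ^ 4) r := by
    intro r hr
    have h := (((((hasDerivAt_pow 2 r).const_sub 1).inv (hne r hr)).pow 3).const_mul (8 / 3 : ℝ))
    refine h.congr_deriv ?_
    have := hne r hr
    simp only [Pi.inv_apply]
    field_simp
    norm_num
    field_simp
    ring
  calc ∫ r in (0 : ℝ)..R, r ^ 3 * (2 / (1 - r ^ 2)) ^ 4
      ≤ ∫ r in (0 : ℝ)..R, 16 * r / (1 - r ^ 2) ^ 4 := by
        refine intervalIntegral.integral_mono_on hR.le hc.intervalIntegrable
          hc'.intervalIntegrable fun r hr => ?_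
        have hr1 : r ^ 3 ≤ r := by
          have h1 := hr.1
          have h2 : r ≤ 1 := hr.2.trans hR1.le
          have h3 : r ^ 2 ≤ 1 := by nlinarith
          nlinarith
        calc r ^ 3 * (2 / (1 - r ^ 2)) ^ 4 ≤ r * (2 / (1 - r ^ 2)) ^ 4 := by gcongr
          _ = _ := by rw [div_pow]; ring
    _ = 8 / 3 * ((1 - R ^ 2)⁻¹) ^ 3 - 8 / 3 * ((1 - 0 ^ 2)⁻¹) ^ 3 :=
        intervalIntegral.integral_eq_sub_of_hasDerivAt hder hc'.intervalIntegrable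
    _ ≤ _ := by norm_num

theorem hypVol_ball_le_exp {ρ : ℝ} (hρ : 0 < ρ) :
    hypVol (Metric.ball 0 (ballRadius ρ)) ≤ ENNReal.ofReal (16 * π ^ 2 / 3 * exp (3 * ρ)) := by
  have hR := ballRadius_pos hρ
  have hR1 := ballRadius_lt_one ρ
  set R := ballRadius ρ with hRdef
  have hd : 0 < 1 - R ^ 2 := by nlinarith
  have hI : IntegrableOn (fun x : E4 => (2 / (1 - ‖x‖ ^ 2)) ^ 4) (Metric.ball 0 R) := by
    refine IntegrableOn.mono_set ?_ Metric.ball_subset_closedBall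
    refine ContinuousOn.integrableOn_compact (isCompact_closedBall _ _) ?_
    have : ∀ x ∈ Metric.closedBall (0 : E4) R, 1 - ‖x‖ ^ 2 ≠ 0 := by
      intro x hx
      rw [mem_closedBall_zero_iff] at hx
      have := norm_nonneg x
      nlinarith
    fun_prop (disch := assumption)
  have hpolar := integral_fun_norm_addHaar (volume : Measure E4)
    (indicator (Iio R) fun r : ℝ => (2 / (1 - r ^ 2)) ^ 4)
  have hleft : (fun x : E4 => indicator (Iio R) (fun r : ℝ => (2 / (1 - r ^ 2)) ^ 4) ‖x‖) =
      indicator (Metric.ball 0 R) fun x : E4 => (2 / (1 - ‖x‖ ^ 2)) ^ 4 := by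
    ext x
    simp [indicator]
  have hright : (fun r : ℝ => r ^ (Module.finrank ℝ E4 - 1) •
        indicator (Iio R) (fun r : ℝ => (2 / (1 - r ^ 2)) ^ 4) r) =
      indicator (Iio R) fun r : ℝ => r ^ 3 * (2 / (1 - r ^ 2)) ^ 4 := by
    ext r
    simp [indicator]
  have hvol : volume.real (Metric.ball (0 : E4) 1) = π ^ 2 / 2 := by
    rw [measureReal_def, volume_ball_zero_E4 zero_le_one, ENNReal.toReal_ofReal (by positivity)]
    ring
  rw [hleft, hright, integral_indicator Metric.isOpen_ball.measurableSet,
    setIntegral_indicator measurableSet_Iio, Ioi_inter_Iio, ← integral_Ioc_eq_integral_Ioo,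
    ← intervalIntegral.integral_of_le hR.le, hvol, finrank_euclideanSpace_fin] at hpolar
  rw [hypVol_ball hR1.le,
    ← ofReal_integral_eq_lintegral_ofReal hI (Eventually.of_forall fun x => by positivity), hpolar]
  refine ENNReal.ofReal_le_ofReal ?_
  have h3 : (1 / (1 - R ^ 2)) ^ 3 ≤ exp (3 * ρ) := by
    have := pow_le_pow_left₀ (by positivity) (inv_one_sub_ballRadius_sq_le hρ.le) 3
    rwa [← exp_nat_mul] at this
  calc _ ≤ 4 • (π ^ 2 / 2) • (8 / 3 * exp (3 * ρ)) := by
        gcongr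
        exact (intervalIntegral_radial_density_le hR hR1).trans (by gcongr)
    _ = _ := by simp only [smul_eq_mul, nsmul_eq_mul]; push_cast; ring

theorem bddBelow_rearr_set (f : E4 → ℝ) (t : ℝ) :
    BddBelow {s : ℝ | 0 < s ∧ hypVol {x : E4 | s < |f x|} ≤ ENNReal.ofReal t} :=
  ⟨0, fun _ hs => hs.1.le⟩

theorem rearr_Ghalf_le {ρ s t : ℝ} (hρ : 0 < ρ) (hs : 0 < s)
    (hG : ∀ r, ρ ≤ r → Ghalf r ≤ s)
    (hvol : hypVol (Metric.ball 0 (ballRadius ρ)) ≤ ENNReal.ofReal t) :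
    rearr (fun x => Ghalf (rhyp x)) t ≤ s := by
  refine csInf_le (bddBelow_rearr_set _ _) ⟨hs, ?_⟩
  have hsub : {x : E4 | s < |Ghalf (rhyp x)|} ⊆
      Metric.ball 0 (ballRadius ρ) ∪ (Metric.ball 0 1)ᶜ := by
    intro x hx
    by_contra hcon
    simp only [mem_union, mem_ball_zero_iff, mem_compl_iff, not_or, not_lt] at hcon
    have hr := le_rhyp hcon.1 (not_le.1 hcon.2)
    rw [mem_ofPred_eq, abs_of_nonneg (Ghalf_nonneg (hρ.trans_le hr))] at hx
    exact absurd (hG _ hr) hx.not_ge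
  calc _ ≤ hypVol (Metric.ball 0 (ballRadius ρ) ∪ (Metric.ball 0 1)ᶜ) := measure_mono hsub
    _ ≤ hypVol (Metric.ball 0 (ballRadius ρ)) + hypVol (Metric.ball (0 : E4) 1)ᶜ :=
        measure_union_le _ _
    _ ≤ ENNReal.ofReal t := by rwa [hypVol_compl_ball, add_zero]

theorem sinh_le_mul_cosh {x : ℝ} (hx : 0 ≤ x) : sinh x ≤ x * cosh x := by
  have h := (convex_Icc 0 x).image_sub_le_mul_sub_of_deriv_le (f := sinh) (C := cosh x)
    continuous_sinh.continuousOn differentiable_sinh.differentiableOn (fun y hy => ?_)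
    0 (left_mem_Icc.2 hx) x (right_mem_Icc.2 hx) hx
  · rw [sinh_zero] at h
    linarith
  · rw [interior_Icc] at hy
    rw [Real.deriv_sinh, cosh_le_cosh, abs_of_pos hy.1, abs_of_nonneg hx]
    exact hy.2.le

theorem rearr_Ghalf_le_of_sinh {σ t : ℝ} (hσ : 0 < σ) (ht : π ^ 2 / 2 * σ ^ 4 ≤ t) :
    rearr (fun x => Ghalf (rhyp x)) t ≤ (1 + σ ^ 2) ^ 3 / (4 * π ^ 2 * σ ^ 3) := by
  have hρ : 0 < arsinh σ := arsinh_pos_iff.2 hσ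
  have hsinh := sinh_arsinh σ
  have hle : arsinh σ ≤ σ := by
    have := self_le_sinh_iff.2 hρ.le
    rwa [hsinh] at this
  have hc := cosh_sq (arsinh σ)
  have hc1 := one_le_cosh (arsinh σ)
  have hmul := sinh_le_mul_cosh hρ.le
  rw [hsinh] at hc hmul
  set ρ := arsinh σ
  refine rearr_Ghalf_le hρ (by positivity) (fun r hr => ?_)
    ((hypVol_ball_le_sinh hρ).trans (ENNReal.ofReal_le_ofReal (by rwa [hsinh])))
  have hr0 : 0 < r := hρ.trans_le hr
  have h3 : σ ^ 3 ≤ ρ ^ 3 * (1 + σ ^ 2) ^ 2 := by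
    calc σ ^ 3 ≤ (ρ * cosh ρ) ^ 3 := by gcongr
      _ = ρ ^ 3 * cosh ρ ^ 3 := by ring
      _ ≤ ρ ^ 3 * cosh ρ ^ 4 := by gcongr; norm_num
      _ = ρ ^ 3 * (cosh ρ ^ 2) ^ 2 := by ring
      _ = _ := by rw [hc]; ring
  calc Ghalf r ≤ (1 + r ^ 2) / (4 * π ^ 2 * r ^ 3) := Ghalf_le hr0
    _ = (1 / r ^ 3 + 1 / r) / (4 * π ^ 2) := by field_simp
    _ ≤ (1 / ρ ^ 3 + 1 / ρ) / (4 * π ^ 2) := by gcongr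
    _ = (1 + ρ ^ 2) / (4 * π ^ 2 * ρ ^ 3) := by field_simp
    _ ≤ (1 + σ ^ 2) / (4 * π ^ 2 * ρ ^ 3) := by gcongr
    _ ≤ (1 + σ ^ 2) ^ 3 / (4 * π ^ 2 * σ ^ 3) := by
      rw [div_le_div_iff₀ (by positivity) (by positivity)]
      calc (1 + σ ^ 2) * (4 * π ^ 2 * σ ^ 3)
          ≤ (1 + σ ^ 2) * (4 * π ^ 2 * (ρ ^ 3 * (1 + σ ^ 2) ^ 2)) := by gcongr
        _ = _ := by ring

theorem rearr_Ghalf_le_mul_one_add_sqrt_pow {t : ℝ} (ht : 0 < t) :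
    rearr (fun x => Ghalf (rhyp x)) t ≤
      (2 : ℝ) ^ ((1 : ℝ) / 4) / (8 * √π * t ^ ((3 : ℝ) / 4)) * (1 + √t) ^ 3 := by
  have ht3 : t ^ ((3 : ℝ) / 4) = (t ^ ((1 : ℝ) / 4)) ^ 3 := by
    rw [← rpow_natCast, ← rpow_mul ht.le]; norm_num
  have ht2 : √t = (t ^ ((1 : ℝ) / 4)) ^ 2 := by
    rw [← rpow_natCast, ← rpow_mul ht.le, sqrt_eq_rpow]; norm_num
  have ht4 : (t ^ ((1 : ℝ) / 4)) ^ 4 = t := by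
    rw [← rpow_natCast, ← rpow_mul ht.le]; norm_num
  have ha4 : ((2 : ℝ) ^ ((1 : ℝ) / 4)) ^ 4 = 2 := by
    rw [← rpow_natCast, ← rpow_mul (by norm_num)]; norm_num
  have hp2 := sq_sqrt pi_pos.le
  rw [ht3, ht2]
  have hb : 0 < t ^ ((1 : ℝ) / 4) := by positivity
  have ha : 0 < (2 : ℝ) ^ ((1 : ℝ) / 4) := by positivity
  have hp : 0 < √π := sqrt_pos.2 pi_pos
  generalize t ^ ((1 : ℝ) / 4) = b at *
  generalize (2 : ℝ) ^ ((1 : ℝ) / 4) = a at *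
  have hπ := pi_gt_three
  have hπ2 : π ^ 2 = √π ^ 4 := by rw [show √π ^ 4 = (√π ^ 2) ^ 2 by ring, hp2]
  have ha2 : a ^ 2 ≤ √π ^ 2 := by
    rw [hp2]
    nlinarith [sq_nonneg (a ^ 2)]
  have hσ4 : π ^ 2 / 2 * (a * b / √π) ^ 4 ≤ t := by
    rw [hπ2, div_pow, mul_pow, ha4, ht4]
    field_simp
    rfl
  refine (rearr_Ghalf_le_of_sinh (by positivity) hσ4).trans ?_
  have hσ2 : (a * b / √π) ^ 2 ≤ b ^ 2 := by
    rw [div_pow, mul_pow, div_le_iff₀ (by positivity), mul_comm]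
    gcongr
  have hcoef : 1 / (4 * π ^ 2 * (a * b / √π) ^ 3) = a / (8 * √π * b ^ 3) := by
    rw [hπ2]
    field_simp
    linarith
  calc (1 + (a * b / √π) ^ 2) ^ 3 / (4 * π ^ 2 * (a * b / √π) ^ 3)
      = 1 / (4 * π ^ 2 * (a * b / √π) ^ 3) * (1 + (a * b / √π) ^ 2) ^ 3 := by ring
    _ ≤ a / (8 * √π * b ^ 3) * (1 + b ^ 2) ^ 3 := by rw [hcoef]; gcongr

theorem exists_rearr_Ghalf_le_of_ge : ∃ C T : ℝ, 0 < C ∧ 2 < T ∧ ∀ t : ℝ, T ≤ t →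
    rearr (fun x => Ghalf (rhyp x)) t ≤ C / (√t * log t) := by
  obtain ⟨K, hK, hG⟩ := exists_Ghalf_le_exp
  set D : ℝ := 16 * π ^ 2 / 3 with hD
  have hD0 : 0 < D := by positivity
  refine ⟨K * √D * 6, max (D ^ 2) (exp 6), by positivity,
    lt_max_of_lt_right (by linarith [add_one_le_exp (6 : ℝ)]), fun t ht => ?_⟩
  have htD : D ^ 2 ≤ t := (le_max_left _ _).trans ht
  have hte : exp 6 ≤ t := (le_max_right _ _).trans ht
  have ht0 : 0 < t := (exp_pos 6).trans_le hte
  have hlog6 : 6 ≤ log t := (le_log_iff_exp_le ht0).2 hte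
  have hlogD : 2 * log D ≤ log t := by
    have := log_le_log (by positivity) htD
    rwa [log_pow] at this
  set ρ := log (t / D) / 3 with hρdef
  have h3ρ : 3 * ρ = log t - log D := by
    rw [hρdef, log_div ht0.ne' hD0.ne']; ring
  have hρ1 : 1 ≤ ρ := by linarith
  have hρ0 : 0 < ρ := by linarith
  have hexp : exp (3 * ρ) = t / D := by
    rw [hρdef, mul_div_cancel₀ _ (by norm_num), exp_log (by positivity)]
  have hexp2 : exp (-(3 / 2 * ρ)) = √D / √t := by
    rw [exp_neg, ← inv_div √t √D, ← sqrt_div ht0.le, ← hexp, ← exp_half]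
    congr 2
    ring
  refine rearr_Ghalf_le hρ0 (by positivity) (fun r hr => ?_)
    ((hypVol_ball_le_exp hρ0).trans (ENNReal.ofReal_le_ofReal ?_))
  · calc Ghalf r ≤ K * (exp (-(3 / 2 * r)) / r) := hG r (hρ1.trans hr)
      _ ≤ K * (exp (-(3 / 2 * ρ)) / ρ) := by gcongr
      _ ≤ K * (exp (-(3 / 2 * ρ)) / (log t / 6)) := by gcongr; linarith
      _ = K * √D * 6 / (√t * log t) := by
        rw [hexp2]
        field_simp
  · rw [hexp, ← hD]
    field_simp
    rfl

theorem exists_rearr_Ghalf_le_sqrt_mul_log : ∃ C : ℝ, 0 < C ∧ ∀ t : ℝ, 2 < t →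
    rearr (fun x => Ghalf (rhyp x)) t ≤ C / (√t * log t) := by
  obtain ⟨C, T, hC, hT, h⟩ := exists_rearr_Ghalf_le_of_ge
  have hlogT : 0 < log T := log_pos (by linarith)
  refine ⟨max C ((1 + √T) ^ 3 * (√T * log T)), lt_max_of_lt_left hC, fun t ht => ?_⟩
  have ht0 : 0 < t := by linarith
  have hlog : 0 < log t := log_pos (by linarith)
  rcases le_total T t with hTt | hTt
  · exact (h t hTt).trans (by gcongr; exact le_max_left _ _)
  · have ha : (2 : ℝ) ^ ((1 : ℝ) / 4) ≤ 2 := by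
      simpa using rpow_le_rpow_of_exponent_le (x := (2 : ℝ)) one_le_two
        (show (1 : ℝ) / 4 ≤ 1 by norm_num)
    have hp : 1 ≤ √π := one_le_sqrt.2 (by linarith [pi_gt_three])
    have ht1 : 1 ≤ t ^ ((3 : ℝ) / 4) := one_le_rpow (by linarith) (by norm_num)
    calc rearr (fun x => Ghalf (rhyp x)) t
        ≤ (2 : ℝ) ^ ((1 : ℝ) / 4) / (8 * √π * t ^ ((3 : ℝ) / 4)) * (1 + √t) ^ 3 :=
          rearr_Ghalf_le_mul_one_add_sqrt_pow ht0
      _ ≤ 1 * (1 + √T) ^ 3 := by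
          gcongr
          rw [div_le_one (by positivity)]
          nlinarith [mul_le_mul hp ht1 zero_le_one (by linarith)]
      _ = (1 + √T) ^ 3 * (√T * log T) / (√T * log T) := by
          have : 0 < √T := sqrt_pos.2 (by linarith)
          field_simp
      _ ≤ max C ((1 + √T) ^ 3 * (√T * log T)) / (√t * log t) := by
          gcongr
          exact le_max_right _ _

theorem Ghalf_rearrangement_estimate :
    ∃ A₂ C : ℝ, 0 < A₂ ∧ 0 < C ∧
      (∀ t : ℝ, 0 < t →
        rearr (fun x => Ghalf (rhyp x)) t
          ≤ ((2 : ℝ) ^ ((1 : ℝ) / 4) / (8 * Real.sqrt π * t ^ ((3 : ℝ) / 4)))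
              * (1 + A₂ * Real.sqrt t)) ∧
      (∀ t : ℝ, 2 < t →
        rearr (fun x => Ghalf (rhyp x)) t ≤ C / (Real.sqrt t * Real.log t)) := by
  obtain ⟨C, hC, h⟩ := exists_rearr_Ghalf_le_sqrt_mul_log
  refine ⟨13 + 16 * √π * C, C, by positivity, hC, fun t ht => ?_, h⟩
  rcases le_or_gt t 4 with ht4 | ht4
  · refine (rearr_Ghalf_le_mul_one_add_sqrt_pow ht).trans ?_
    have h0 := sqrt_nonneg t
    have h2 : √t ≤ 2 := sqrt_le_iff.2 ⟨by norm_num, by linarith⟩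
    gcongr
    have h3 : 0 ≤ 16 * √π * C * √t := by positivity
    nlinarith [mul_nonneg h0 (sub_nonneg.2 h2), mul_nonneg (mul_nonneg h0 h0) (sub_nonneg.2 h2)]
  · refine (h t (by linarith)).trans ?_
    have hlog : 1 / 2 ≤ log t := by
      have := log_le_log two_pos (show 2 ≤ t by linarith)
      linarith [log_two_gt_d9]
    have ha : 1 ≤ (2 : ℝ) ^ ((1 : ℝ) / 4) := one_le_rpow one_le_two (by norm_num)
    have ht34 : t ^ ((3 : ℝ) / 4) ≤ √t * √t := by
      rw [mul_self_sqrt ht.le]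
      simpa using rpow_le_rpow_of_exponent_le (show 1 ≤ t by linarith)
        (show (3 : ℝ) / 4 ≤ 1 by norm_num)
    have hp : 0 < √π := sqrt_pos.2 pi_pos
    have hs : 0 < √t := sqrt_pos.2 ht
    calc C / (√t * log t) ≤ C / (√t * (1 / 2)) := by gcongr
      _ = 1 / (8 * √π * (√t * √t)) * (16 * √π * C * √t) := by field_simp; norm_num
      _ ≤ (2 : ℝ) ^ ((1 : ℝ) / 4) / (8 * √π * t ^ ((3 : ℝ) / 4)) * (16 * √π * C * √t) := by
        gcongr
      _ ≤ _ := by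
        gcongr
        nlinarith
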